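/- arXiv:1608.05438 — 2 statements merged into one kernel-verified Lean document; each statement's English description precedes it below -/
import Mathlib

section
/- Let F : [0,∞) → (0,∞)^I be a solution of the combined system dF_{k₁}/dt = 𝒞₁₂[F](k₁) + 𝒞₂₂[F](k₁) + 𝒞₁₃[F](k₁), k₁ ∈ 𝕀, with I ≥ 3. Then there exist a constant ρ > 0 and constants C₁, C₂ > 0 such that Σ_{k=1}^I k/(e^{ρk} − 1) = Σ_{k=1}^I k·F_k(0) and max_{1≤k≤I} |F_k(t) − 1/(e^{ρk} − 1)| ≤ C₁ e^{−C₂ t} for all t ≥ 0; that is, F(t) converges exponentially fast to the equilibrium F*_k = 1/(e^{ρk} − 1) having the same energy as the initial condition. -/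
/-- The right-hand side of the discrete `C₁₂` collision operator for `k₁ ∈ {1,…,I}`. -/
noncomputable def C12 (I : ℕ) (K : ℕ → ℕ → ℕ → ℝ) (F : ℕ → ℝ) (k₁ : ℕ) : ℝ :=
  (∑ k₂ ∈ Finset.Icc 1 I, ∑ k₃ ∈ Finset.Icc 1 I,
    if k₂ + k₃ = k₁ then
      K k₁ k₂ k₃ * ((F k₁ + 1) * F k₂ * F k₃ - F k₁ * (F k₂ + 1) * (F k₃ + 1))
    else 0)
  - 2 * (∑ k₂ ∈ Finset.Icc 1 I, ∑ k₃ ∈ Finset.Icc 1 I,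
    if k₁ + k₃ = k₂ then
      K k₂ k₁ k₃ * ((F k₂ + 1) * F k₁ * F k₃ - F k₂ * (F k₁ + 1) * (F k₃ + 1))
    else 0)

/-- The right-hand side of the discrete `C₂₂` collision operator for `k₁ ∈ {1,…,I}`. -/
noncomputable def C22 (I : ℕ) (K : ℕ → ℕ → ℕ → ℕ → ℝ) (F : ℕ → ℝ) (k₁ : ℕ) : ℝ :=
  ∑ k₂ ∈ Finset.Icc 1 I, ∑ k₃ ∈ Finset.Icc 1 I, ∑ k₄ ∈ Finset.Icc 1 I,
    if k₁ + k₂ = k₃ + k₄ then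
      K k₁ k₂ k₃ k₄ * ((F k₁ + 1) * (F k₂ + 1) * F k₃ * F k₄
        - F k₁ * F k₂ * (F k₃ + 1) * (F k₄ + 1))
    else 0

/-- The right-hand side of the discrete `C₁₃` collision operator for `k₁ ∈ {1,…,I}`. -/
noncomputable def C13 (I : ℕ) (K : ℕ → ℕ → ℕ → ℕ → ℝ) (F : ℕ → ℝ) (k₁ : ℕ) : ℝ :=
  (∑ k₂ ∈ Finset.Icc 1 I, ∑ k₃ ∈ Finset.Icc 1 I, ∑ k₄ ∈ Finset.Icc 1 I,
    if k₂ + k₃ + k₄ = k₁ then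
      K k₁ k₂ k₃ k₄ * ((F k₁ + 1) * F k₂ * F k₃ * F k₄
        - F k₁ * (F k₂ + 1) * (F k₃ + 1) * (F k₄ + 1))
    else 0)
  - 3 * (∑ k₂ ∈ Finset.Icc 1 I, ∑ k₃ ∈ Finset.Icc 1 I, ∑ k₄ ∈ Finset.Icc 1 I,
    if k₁ + k₃ + k₄ = k₂ then
      K k₂ k₁ k₃ k₄ * ((F k₂ + 1) * F k₁ * F k₃ * F k₄
        - F k₂ * (F k₁ + 1) * (F k₃ + 1) * (F k₄ + 1))
    else 0)

theorem aux_log_ineq (a b : ℝ) (ha : 0 < a) (ha1 : a ≤ 1) (hb : 0 < b) (hb1 : b ≤ 1) :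
    (a - b) ^ 2 ≤ (a - b) * (Real.log a - Real.log b) := by
  have key : ∀ a b : ℝ, 0 < a → a ≤ 1 → 0 < b → b ≤ a → a - b ≤ Real.log a - Real.log b := by
    intro a b ha ha1 hb hba
    have h := Real.one_sub_inv_le_log_of_pos (div_pos ha hb)
    rw [Real.log_div ha.ne' hb.ne', inv_div] at h
    have : a - b ≤ 1 - b / a := by
      rw [one_sub_div ha.ne', le_div_iff₀ ha]; nlinarith
    linarith
  rcases le_total b a with h | h
  · have := key a b ha ha1 hb h
    nlinarith
  · have := key b a hb hb1 ha h
    nlinarith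

theorem aux_log_mono (p q : ℝ) (hp : 0 < p) (hq : 0 < q) :
    (p - q) * (Real.log q - Real.log p) ≤ 0 := by
  rcases le_total p q with h | h
  · have := Real.log_le_log hp h
    nlinarith
  · have := Real.log_le_log hq h
    nlinarith

noncomputable def hrel (f g : ℝ) : ℝ :=
  f * (Real.log f - Real.log g) - (f + 1) * (Real.log (f + 1) - Real.log (g + 1))

theorem hrel_nonneg (f g : ℝ) (hf : 0 < f) (hg : 0 < g) : 0 ≤ hrel f g := by
  have hf1 : 0 < f + 1 := by linarith
  have hg1 : 0 < g + 1 := by linarith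
  have h1 := Real.log_le_sub_one_of_pos (x := g * (f + 1) / (f * (g + 1))) (by positivity)
  have h2 := Real.log_le_sub_one_of_pos (x := (f + 1) / (g + 1)) (by positivity)
  rw [Real.log_div (by positivity) (by positivity), Real.log_mul hg.ne' hf1.ne',
    Real.log_mul hf.ne' hg1.ne'] at h1
  rw [Real.log_div (by positivity) (by positivity)] at h2
  have h3 := mul_le_mul_of_nonneg_left h1 hf.le
  have h4 : f * (g * (f + 1) / (f * (g + 1)) - 1) + ((f + 1) / (g + 1) - 1) = 0 := by
    field_simp; ring
  unfold hrel
  nlinarith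

theorem hrel_upper (f g : ℝ) (hf : 0 < f) (hg : 0 < g) : hrel f g ≤ (f - g) ^ 2 / g := by
  have hf1 : 0 < f + 1 := by linarith
  have hg1 : 0 < g + 1 := by linarith
  have h1 := Real.log_le_sub_one_of_pos (x := f / g) (by positivity)
  have h2 := Real.log_le_sub_one_of_pos (x := (g + 1) / (f + 1)) (by positivity)
  rw [Real.log_div (by positivity) (by positivity)] at h1 h2
  have h3 := mul_le_mul_of_nonneg_left h1 hf.le
  have h4 := mul_le_mul_of_nonneg_left h2 hf1.le
  have h5 : f * (f / g - 1) + (f + 1) * ((g + 1) / (f + 1) - 1) = (f - g) ^ 2 / g := by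
    field_simp; ring
  unfold hrel
  nlinarith

theorem aux_x_mono (E f g : ℝ) (hf : 0 < f) (hg : 0 < g) (hfE : f ≤ E) (hgE : g ≤ E) :
    (f - g) ^ 2 / (E + 1) ^ 2 ≤
      (f - g) * ((Real.log f - Real.log (f + 1)) - (Real.log g - Real.log (g + 1))) := by
  have hf1 : 0 < f + 1 := by linarith
  have hg1 : 0 < g + 1 := by linarith
  have h := aux_log_ineq (f / (f + 1)) (g / (g + 1)) (by positivity)
    (by rw [div_le_one hf1]; linarith) (by positivity) (by rw [div_le_one hg1]; linarith)
  rw [Real.log_div hf.ne' hf1.ne', Real.log_div hg.ne' hg1.ne'] at h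
  have e : f / (f + 1) - g / (g + 1) = (f - g) / ((f + 1) * (g + 1)) := by field_simp; ring
  rw [e] at h
  set L := (Real.log f - Real.log (f + 1)) - (Real.log g - Real.log (g + 1)) with hL
  set P := (f + 1) * (g + 1) with hP
  have hPp : 0 < P := by positivity
  have h' : (f - g) ^ 2 / P ≤ (f - g) * L := by
    have := mul_le_mul_of_nonneg_left h hPp.le
    have e1 : P * ((f - g) / P) ^ 2 = (f - g) ^ 2 / P := by field_simp
    have e2 : P * ((f - g) / P * L) = (f - g) * L := by field_simp
    rwa [e1, e2] at this
  refine le_trans ?_ h'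
  apply div_le_div_of_nonneg_left (sq_nonneg _) hPp
  rw [hP]; nlinarith

theorem hrel_lower (E f g : ℝ) (hf : 0 < f) (hg : 0 < g) (hfE : f ≤ E) (hgE : g ≤ E) :
    (f - g) ^ 2 / (4 * (E + 1) ^ 2) ≤ hrel f g := by
  have hm : 0 < (f + g) / 2 := by linarith
  have h1 := hrel_nonneg f ((f + g) / 2) hf hm
  have h2 := hrel_nonneg ((f + g) / 2) g hm hg
  have h3 := aux_x_mono E ((f + g) / 2) g hm hg (by linarith) hgE
  set m := (f + g) / 2 with hmd
  have e : m - g = (f - g) / 2 := by rw [hmd]; ring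
  rw [e] at h3
  have e2 : ((f - g) / 2) ^ 2 / (E + 1) ^ 2 = (f - g) ^ 2 / (4 * (E + 1) ^ 2) := by
    rw [div_pow, div_div]; norm_num
  rw [e2] at h3
  have hfm : f = 2 * m - g := by rw [hmd]; ring
  unfold hrel at *
  generalize Real.log f = lf at *
  generalize Real.log (f + 1) = lf1 at *
  have : (f - g) / 2 = m - g := e.symm
  rw [this] at h3
  have hid : f * (lf - Real.log g) - (f + 1) * (lf1 - Real.log (g + 1)) =
      (f * (lf - Real.log m) - (f + 1) * (lf1 - Real.log (m + 1))) +
      (m * (Real.log m - Real.log g) - (m + 1) * (Real.log (m + 1) - Real.log (g + 1))) +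
      (m - g) * (Real.log m - Real.log (m + 1) - (Real.log g - Real.log (g + 1))) := by
    have : m - g = f - m := by rw [hfm]; ring
    rw [this]; ring
  linarith

theorem hrel_deriv (u : ℝ → ℝ) (g u' t : ℝ) (s : Set ℝ) (hu : HasDerivWithinAt u u' s t)
    (hp : 0 < u t) :
    HasDerivWithinAt (fun s => hrel (u s) g)
      (((Real.log (u t) - Real.log (u t + 1)) - (Real.log g - Real.log (g + 1))) * u') s t := by
  have hp1 : 0 < u t + 1 := by linarith
  have h1 := hu.mul ((hu.log hp.ne').sub_const (Real.log g))
  have hu1 := hu.add_const 1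
  have h2 := hu1.mul ((hu1.log hp1.ne').sub_const (Real.log (g + 1)))
  refine (h1.sub h2).congr_deriv ?_
  field_simp
  ring

theorem aux_stab (I : ℕ) (hI : 3 ≤ I) (E r ε : ℝ) (f : ℕ → ℝ)
    (hf : ∀ k ∈ Finset.Icc 1 I, 0 < f k) (hr0 : 0 < r) (hr1 : r < 1)
    (hE : ∑ k ∈ Finset.Icc 1 I, (k : ℝ) * f k = E)
    (hrE : ∑ k ∈ Finset.Icc 1 I, (k : ℝ) * (r ^ k / (1 - r ^ k)) = E)
    (hfE : ∀ k ∈ Finset.Icc 1 I, f k ≤ E)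
    (hε : 0 ≤ ε)
    (hd : ∀ k, 1 ≤ k → k + 1 ≤ I →
      |f 1 / (f 1 + 1) * (f k / (f k + 1)) - f (k + 1) / (f (k + 1) + 1)| ≤ ε) :
    ∀ k ∈ Finset.Icc 1 I, |f k - r ^ k / (1 - r ^ k)| ≤
      ((E + 1) ^ 2 * I * (1 + (I : ℝ) ^ 2)) * ε := by
  have h1m : (1 : ℕ) ∈ Finset.Icc 1 I := by simp; omega
  have hf1 := hf 1 h1m
  have hE0 : 0 < E := lt_of_lt_of_le hf1 (hfE 1 h1m)
  set a := f 1 / (f 1 + 1) with ha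
  have ha0 : 0 < a := by positivity
  have haE : a ≤ E / (E + 1) := by
    rw [ha, div_le_div_iff₀ (by linarith) (by linarith)]
    nlinarith [hfE 1 h1m]
  have hEl : E / (E + 1) < 1 := by rw [div_lt_one (by linarith)]; linarith
  have ha1 : a < 1 := lt_of_le_of_lt haE hEl
  have hG : ∀ k, 1 ≤ k → k ≤ I → |f k / (f k + 1) - a ^ k| ≤ k * ε := by
    intro k hk
    induction k, hk using Nat.le_induction with
    | base => intro _; simp [← ha]; exact hε
    | succ k hk ih =>
      intro hkI
      have h1 := ih (by omega)
      have h2 := hd k hk hkI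
      have e : f (k + 1) / (f (k + 1) + 1) - a ^ (k + 1) =
        -(a * (f k / (f k + 1)) - f (k + 1) / (f (k + 1) + 1)) +
          a * (f k / (f k + 1) - a ^ k) := by ring
      rw [e]
      refine (abs_add_le _ _).trans ?_
      rw [abs_neg, abs_mul, abs_of_pos ha0]
      push_cast
      nlinarith [abs_nonneg (f k / (f k + 1) - a ^ k)]
  set M := (E + 1) ^ 2 * I * ε with hM
  have hM0 : 0 ≤ M := by positivity
  have hak : ∀ k, 1 ≤ k → a ^ k ≤ E / (E + 1) := by
    intro k hk
    exact (pow_le_of_le_one ha0.le ha1.le (by omega)).trans haE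
  have hP : ∀ k ∈ Finset.Icc 1 I, |f k - a ^ k / (1 - a ^ k)| ≤ M := by
    intro k hk
    have hk' := Finset.mem_Icc.1 hk
    have h := hG k hk'.1 hk'.2
    have hfk := hf k hk
    have hy : 1 / (E + 1) ≤ 1 - a ^ k := by
      have := hak k hk'.1
      have e : E / (E + 1) = 1 - 1 / (E + 1) := by field_simp; ring
      linarith
    have hy0 : 0 < 1 - a ^ k := lt_of_lt_of_le (by positivity) hy
    have e : f k - a ^ k / (1 - a ^ k) =
        (f k / (f k + 1) - a ^ k) * ((f k + 1) * (1 / (1 - a ^ k))) := by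
      field_simp; ring
    have hq0 : 0 ≤ (f k + 1) * (1 / (1 - a ^ k)) := by positivity
    rw [e, abs_mul, abs_of_nonneg hq0]
    have hq : (f k + 1) * (1 / (1 - a ^ k)) ≤ (E + 1) * (E + 1) := by
      apply mul_le_mul _ _ (by positivity) (by positivity)
      · linarith [hfE k hk]
      · rw [div_le_iff₀ hy0]
        rw [div_le_iff₀ (by linarith)] at hy
        linarith
    have hkI : (k : ℝ) * ε ≤ I * ε := by
      apply mul_le_mul_of_nonneg_right _ hε
      exact_mod_cast hk'.2
    calc _ ≤ (I * ε) * ((E + 1) * (E + 1)) := mul_le_mul (h.trans hkI) hq hq0 (by positivity)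
      _ = M := by rw [hM]; ring
  have hS : |∑ k ∈ Finset.Icc 1 I, (k : ℝ) * (a ^ k / (1 - a ^ k) - r ^ k / (1 - r ^ k))|
      ≤ I ^ 2 * M := by
    have e : ∑ k ∈ Finset.Icc 1 I, (k : ℝ) * (a ^ k / (1 - a ^ k) - r ^ k / (1 - r ^ k)) =
        ∑ k ∈ Finset.Icc 1 I, (k : ℝ) * (a ^ k / (1 - a ^ k) - f k) := by
      simp only [mul_sub, Finset.sum_sub_distrib]
      rw [hE, hrE]
    rw [e]
    refine (Finset.abs_sum_le_sum_abs _ _).trans ?_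
    have : ∀ k ∈ Finset.Icc 1 I, |(k : ℝ) * (a ^ k / (1 - a ^ k) - f k)| ≤ I * M := by
      intro k hk
      rw [abs_mul, abs_sub_comm, abs_of_nonneg (Nat.cast_nonneg k)]
      apply mul_le_mul _ (hP k hk) (abs_nonneg _) (Nat.cast_nonneg _)
      exact_mod_cast (Finset.mem_Icc.1 hk).2
    refine (Finset.sum_le_card_nsmul _ _ _ this).trans ?_
    simp
    apply le_of_eq; ring
  have hphi : ∀ x y : ℝ, 0 < x → x ≤ y → y < 1 → ∀ k, 1 ≤ k →
      x ^ k / (1 - x ^ k) ≤ y ^ k / (1 - y ^ k) := by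
    intro x y hx hxy hy k hk
    have h1 : x ^ k ≤ y ^ k := pow_le_pow_left₀ hx.le hxy k
    have h2 : y ^ k < 1 := pow_lt_one₀ (hx.le.trans hxy) hy (by omega)
    rw [div_le_div_iff₀ (by linarith) (by linarith)]
    nlinarith
  have hsing : ∀ x y : ℝ, 0 < x → x ≤ y → y < 1 → ∀ k ∈ Finset.Icc 1 I,
      y ^ k / (1 - y ^ k) - x ^ k / (1 - x ^ k) ≤
      ∑ k ∈ Finset.Icc 1 I, (k : ℝ) * (y ^ k / (1 - y ^ k) - x ^ k / (1 - x ^ k)) := by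
    intro x y hx hxy hy k hk
    have h := Finset.single_le_sum
      (f := fun k : ℕ => (k : ℝ) * (y ^ k / (1 - y ^ k) - x ^ k / (1 - x ^ k)))
      (fun j hj => mul_nonneg (Nat.cast_nonneg j)
        (sub_nonneg.2 (hphi x y hx hxy hy j (Finset.mem_Icc.1 hj).1))) hk
    refine le_trans ?_ h
    have h1 := hphi x y hx hxy hy k (Finset.mem_Icc.1 hk).1
    have h2 : (1 : ℝ) ≤ k := by exact_mod_cast (Finset.mem_Icc.1 hk).1
    nlinarith
  intro k hk
  have hR : |a ^ k / (1 - a ^ k) - r ^ k / (1 - r ^ k)| ≤ I ^ 2 * M := by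
    refine le_trans ?_ hS
    rcases le_total a r with h | h
    · have h1 := hsing a r ha0 h hr1 k hk
      have h2 := hphi a r ha0 h hr1 k (Finset.mem_Icc.1 hk).1
      rw [abs_sub_comm, abs_of_nonneg (by linarith)]
      refine h1.trans ?_
      rw [← abs_neg, ← Finset.sum_neg_distrib]
      refine le_trans (le_of_eq ?_) (le_abs_self _)
      apply Finset.sum_congr rfl; intros; ring
    · have h1 := hsing r a hr0 h ha1 k hk
      have h2 := hphi r a hr0 h ha1 k (Finset.mem_Icc.1 hk).1
      rw [abs_of_nonneg (by linarith)]
      exact h1.trans (le_abs_self _)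
  have := abs_sub_le (f k) (a ^ k / (1 - a ^ k)) (r ^ k / (1 - r ^ k))
  have h3 := hP k hk
  calc _ ≤ M + I ^ 2 * M := by linarith
    _ = _ := by rw [hM]; ring

theorem aux_exists_r (I : ℕ) (hI : 3 ≤ I) (E : ℝ) (hE : 0 < E) :
    ∃ r : ℝ, 0 < r ∧ r < 1 ∧ ∑ k ∈ Finset.Icc 1 I, (k : ℝ) * (r ^ k / (1 - r ^ k)) = E := by
  have hEl : E / (E + 1) < 1 := by rw [div_lt_one (by linarith)]; linarith
  have hE0 : 0 ≤ E / (E + 1) := by positivity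
  set S : ℝ → ℝ := fun r => ∑ k ∈ Finset.Icc 1 I, (k : ℝ) * (r ^ k / (1 - r ^ k)) with hS
  have hc : ContinuousOn S (Set.Icc 0 (E / (E + 1))) := by
    apply continuousOn_finsetSum
    intro k hk
    apply ContinuousOn.mul continuousOn_const
    apply ContinuousOn.div (by fun_prop) (by fun_prop)
    intro x hx
    have : x ^ k < 1 := pow_lt_one₀ hx.1 (lt_of_le_of_lt hx.2 hEl)
      (by have := (Finset.mem_Icc.1 hk).1; omega)
    linarith
  have h0 : S 0 = 0 := by
    apply Finset.sum_eq_zero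
    intro k hk
    have : k ≠ 0 := by have := (Finset.mem_Icc.1 hk).1; omega
    simp [this]
  have h1 : E ≤ S (E / (E + 1)) := by
    have h := Finset.single_le_sum (s := Finset.Icc 1 I)
      (f := fun k : ℕ => (k : ℝ) * ((E / (E + 1)) ^ k / (1 - (E / (E + 1)) ^ k)))
      (fun j hj => by
        have : (E / (E + 1)) ^ j ≤ 1 := pow_le_one₀ hE0 hEl.le
        have : 0 ≤ 1 - (E / (E + 1)) ^ j := by linarith
        positivity) (show 1 ∈ Finset.Icc 1 I by simp; omega)
    refine le_trans (le_of_eq ?_) h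
    simp
    field_simp
    ring
  obtain ⟨r, hr, hrE⟩ := intermediate_value_Icc hE0 hc (show E ∈ Set.Icc (S 0) _ from
    ⟨by rw [h0]; exact hE.le, h1⟩)
  refine ⟨r, lt_of_le_of_ne hr.1 ?_, lt_of_le_of_lt hr.2 hEl, hrE⟩
  rintro rfl
  rw [h0] at hrE
  exact hE.ne hrE

theorem aux_weak3 (s : Finset ℕ) (T : ℕ → ℕ → ℕ → ℝ) (φ : ℕ → ℝ)
    (hT : ∀ a b c, T a b c = T a c b) :
    ∑ k ∈ s, φ k * ((∑ b ∈ s, ∑ c ∈ s, T k b c) - 2 * ∑ a ∈ s, ∑ c ∈ s, T a k c) =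
    ∑ a ∈ s, ∑ b ∈ s, ∑ c ∈ s, T a b c * (φ a - φ b - φ c) := by
  have h1 : ∑ a ∈ s, ∑ b ∈ s, ∑ c ∈ s, T a b c * φ c =
      ∑ a ∈ s, ∑ b ∈ s, ∑ c ∈ s, T a b c * φ b := by
    refine Finset.sum_congr rfl fun a _ => ?_
    rw [Finset.sum_comm]
    simp_rw [hT a]
  have h2 : ∑ k ∈ s, φ k * ∑ a ∈ s, ∑ c ∈ s, T a k c =
      ∑ a ∈ s, ∑ b ∈ s, ∑ c ∈ s, T a b c * φ b := by
    simp_rw [Finset.mul_sum]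
    rw [Finset.sum_comm]
    simp_rw [mul_comm]
  have h3 : ∑ k ∈ s, φ k * ∑ b ∈ s, ∑ c ∈ s, T k b c =
      ∑ a ∈ s, ∑ b ∈ s, ∑ c ∈ s, T a b c * φ a := by
    simp_rw [Finset.mul_sum, mul_comm]
  simp_rw [mul_sub, Finset.sum_sub_distrib, h1, h3, mul_left_comm _ (2 : ℝ), ← Finset.mul_sum, h2]
  ring

theorem aux_weak13 (s : Finset ℕ) (T : ℕ → ℕ → ℕ → ℕ → ℝ) (φ : ℕ → ℝ)
    (hT : ∀ a b c d, T a b c d = T a c b d) (hT' : ∀ a b c d, T a b c d = T a b d c) :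
    ∑ k ∈ s, φ k * ((∑ b ∈ s, ∑ c ∈ s, ∑ d ∈ s, T k b c d) -
      3 * ∑ a ∈ s, ∑ c ∈ s, ∑ d ∈ s, T a k c d) =
    ∑ a ∈ s, ∑ b ∈ s, ∑ c ∈ s, ∑ d ∈ s, T a b c d * (φ a - φ b - φ c - φ d) := by
  have h0 : ∑ a ∈ s, ∑ b ∈ s, ∑ c ∈ s, ∑ d ∈ s, T a b c d * φ d =
      ∑ a ∈ s, ∑ b ∈ s, ∑ c ∈ s, ∑ d ∈ s, T a b c d * φ c := by
    refine Finset.sum_congr rfl fun a _ => Finset.sum_congr rfl fun b _ => ?_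
    rw [Finset.sum_comm]
    refine Finset.sum_congr rfl fun c _ => Finset.sum_congr rfl fun d _ => ?_
    rw [hT']
  have h1 : ∑ a ∈ s, ∑ b ∈ s, ∑ c ∈ s, ∑ d ∈ s, T a b c d * φ c =
      ∑ a ∈ s, ∑ b ∈ s, ∑ c ∈ s, ∑ d ∈ s, T a b c d * φ b := by
    refine Finset.sum_congr rfl fun a _ => ?_
    rw [Finset.sum_comm]
    refine Finset.sum_congr rfl fun b _ => Finset.sum_congr rfl fun c _ =>
      Finset.sum_congr rfl fun d _ => ?_
    rw [hT]
  have h2 : ∑ k ∈ s, φ k * ∑ a ∈ s, ∑ c ∈ s, ∑ d ∈ s, T a k c d =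
      ∑ a ∈ s, ∑ b ∈ s, ∑ c ∈ s, ∑ d ∈ s, T a b c d * φ b := by
    simp_rw [Finset.mul_sum]
    rw [Finset.sum_comm]
    simp_rw [mul_comm]
  have h3 : ∑ k ∈ s, φ k * ∑ b ∈ s, ∑ c ∈ s, ∑ d ∈ s, T k b c d =
      ∑ a ∈ s, ∑ b ∈ s, ∑ c ∈ s, ∑ d ∈ s, T a b c d * φ a := by
    simp_rw [Finset.mul_sum, mul_comm]
  simp_rw [mul_sub, Finset.sum_sub_distrib, h0, h1, h3, mul_left_comm _ (3 : ℝ),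
    ← Finset.mul_sum, h2]
  ring

theorem aux_weak22 (s : Finset ℕ) (T : ℕ → ℕ → ℕ → ℕ → ℝ) (φ : ℕ → ℝ)
    (hT : ∀ a b c d, T a b c d = T b a c d) (hT' : ∀ a b c d, T a b c d = T a b d c)
    (hT2 : ∀ a b c d, T a b c d = - T c d a b) :
    ∑ k ∈ s, φ k * (∑ b ∈ s, ∑ c ∈ s, ∑ d ∈ s, T k b c d) =
    (1 / 4) * ∑ a ∈ s, ∑ b ∈ s, ∑ c ∈ s, ∑ d ∈ s, T a b c d * (φ a + φ b - φ c - φ d) := by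
  have h0 : ∑ a ∈ s, ∑ b ∈ s, ∑ c ∈ s, ∑ d ∈ s, T a b c d * φ d =
      ∑ a ∈ s, ∑ b ∈ s, ∑ c ∈ s, ∑ d ∈ s, T a b c d * φ c := by
    refine Finset.sum_congr rfl fun a _ => Finset.sum_congr rfl fun b _ => ?_
    rw [Finset.sum_comm]
    refine Finset.sum_congr rfl fun c _ => Finset.sum_congr rfl fun d _ => ?_
    rw [hT']
  have h1 : ∑ a ∈ s, ∑ b ∈ s, ∑ c ∈ s, ∑ d ∈ s, T a b c d * φ b =
      ∑ a ∈ s, ∑ b ∈ s, ∑ c ∈ s, ∑ d ∈ s, T a b c d * φ a := by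
    rw [Finset.sum_comm]
    refine Finset.sum_congr rfl fun a _ => Finset.sum_congr rfl fun b _ => 
      Finset.sum_congr rfl fun c _ => Finset.sum_congr rfl fun d _ => ?_
    rw [hT]
  have h2 : ∑ a ∈ s, ∑ b ∈ s, ∑ c ∈ s, ∑ d ∈ s, T a b c d * φ c =
      - ∑ a ∈ s, ∑ b ∈ s, ∑ c ∈ s, ∑ d ∈ s, T a b c d * φ a := by
    calc _ = ∑ a ∈ s, ∑ c ∈ s, ∑ b ∈ s, ∑ d ∈ s, T a b c d * φ c :=
          Finset.sum_congr rfl fun a _ => Finset.sum_comm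
      _ = ∑ c ∈ s, ∑ a ∈ s, ∑ b ∈ s, ∑ d ∈ s, T a b c d * φ c := Finset.sum_comm
      _ = ∑ c ∈ s, ∑ a ∈ s, ∑ d ∈ s, ∑ b ∈ s, T a b c d * φ c :=
          Finset.sum_congr rfl fun c _ => Finset.sum_congr rfl fun a _ => Finset.sum_comm
      _ = ∑ c ∈ s, ∑ d ∈ s, ∑ a ∈ s, ∑ b ∈ s, T a b c d * φ c :=
          Finset.sum_congr rfl fun c _ => Finset.sum_comm
      _ = _ := by
        simp_rw [← Finset.sum_neg_distrib]
        refine Finset.sum_congr rfl fun a _ => Finset.sum_congr rfl fun b _ => 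
          Finset.sum_congr rfl fun c _ => Finset.sum_congr rfl fun d _ => ?_
        rw [hT2]; ring
  have h3 : ∑ k ∈ s, φ k * ∑ b ∈ s, ∑ c ∈ s, ∑ d ∈ s, T k b c d =
      ∑ a ∈ s, ∑ b ∈ s, ∑ c ∈ s, ∑ d ∈ s, T a b c d * φ a := by
    simp_rw [Finset.mul_sum, mul_comm]
  simp_rw [mul_sub, mul_add, Finset.sum_sub_distrib, Finset.sum_add_distrib, h0, h1, h3, h2]
  ring

/-- weak form of `C12` -/
theorem C12_weak (I : ℕ) (K : ℕ → ℕ → ℕ → ℝ)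
    (hs : ∀ a b c, K a b c = K b a c ∧ K a b c = K a c b) (f φ : ℕ → ℝ) :
    ∑ k ∈ Finset.Icc 1 I, φ k * C12 I K f k =
    ∑ a ∈ Finset.Icc 1 I, ∑ b ∈ Finset.Icc 1 I, ∑ c ∈ Finset.Icc 1 I,
      (if b + c = a then
        K a b c * ((f a + 1) * f b * f c - f a * (f b + 1) * (f c + 1)) else 0)
        * (φ a - φ b - φ c) := by
  refine aux_weak3 _ (fun a b c => if b + c = a then
        K a b c * ((f a + 1) * f b * f c - f a * (f b + 1) * (f c + 1)) else 0) φ ?_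
  intro a b c
  simp only [add_comm c b]
  rw [(hs a b c).2]
  split_ifs <;> ring

theorem C13_weak (I : ℕ) (K : ℕ → ℕ → ℕ → ℕ → ℝ)
    (hs : ∀ a b c d, K a b c d = K b a c d ∧ K a b c d = K a c b d ∧ K a b c d = K a b d c)
    (f φ : ℕ → ℝ) :
    ∑ k ∈ Finset.Icc 1 I, φ k * C13 I K f k =
    ∑ a ∈ Finset.Icc 1 I, ∑ b ∈ Finset.Icc 1 I, ∑ c ∈ Finset.Icc 1 I, ∑ d ∈ Finset.Icc 1 I,
      (if b + c + d = a then
        K a b c d * ((f a + 1) * f b * f c * f d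
          - f a * (f b + 1) * (f c + 1) * (f d + 1)) else 0)
        * (φ a - φ b - φ c - φ d) := by
  refine aux_weak13 _ (fun a b c d => if b + c + d = a then
        K a b c d * ((f a + 1) * f b * f c * f d
          - f a * (f b + 1) * (f c + 1) * (f d + 1)) else 0) φ ?_ ?_
  · intro a b c d
    simp only [add_comm c b]
    rw [(hs a b c d).2.1]
    split_ifs <;> ring
  · intro a b c d
    simp only [add_right_comm b d c]
    rw [(hs a b c d).2.2]
    split_ifs <;> ring

theorem C22_weak (I : ℕ) (K : ℕ → ℕ → ℕ → ℕ → ℝ)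
    (hs : ∀ a b c d, K a b c d = K b a c d ∧ K a b c d = K a c b d ∧ K a b c d = K a b d c)
    (f φ : ℕ → ℝ) :
    ∑ k ∈ Finset.Icc 1 I, φ k * C22 I K f k =
    (1 / 4) * ∑ a ∈ Finset.Icc 1 I, ∑ b ∈ Finset.Icc 1 I, ∑ c ∈ Finset.Icc 1 I,
      ∑ d ∈ Finset.Icc 1 I,
      (if a + b = c + d then
        K a b c d * ((f a + 1) * (f b + 1) * f c * f d
          - f a * f b * (f c + 1) * (f d + 1)) else 0)
        * (φ a + φ b - φ c - φ d) := by
  refine aux_weak22 _ (fun a b c d => if a + b = c + d then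
        K a b c d * ((f a + 1) * (f b + 1) * f c * f d
          - f a * f b * (f c + 1) * (f d + 1)) else 0) φ ?_ ?_ ?_
  · intro a b c d
    simp only [add_comm b a]
    rw [(hs a b c d).1]
    split_ifs <;> ring
  · intro a b c d
    simp only [add_comm d c]
    rw [(hs a b c d).2.2]
    split_ifs <;> ring
  · intro a b c d
    simp only [eq_comm (a := c + d) (b := a + b)]
    have : K a b c d = K c d a b := by
      rw [(hs a b c d).2.1, (hs a c b d).1, (hs c a b d).2.2, (hs c a d b).2.1]
    rw [this]
    split_ifs <;> ring

theorem aux_energy (I : ℕ) 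
    (K12 : ℕ → ℕ → ℕ → ℝ) (K22 K13 : ℕ → ℕ → ℕ → ℕ → ℝ)
    (hK12symm : ∀ a b c, K12 a b c = K12 b a c ∧ K12 a b c = K12 a c b)
    (hK22symm : ∀ a b c d, K22 a b c d = K22 b a c d ∧ K22 a b c d = K22 a c b d ∧
      K22 a b c d = K22 a b d c)
    (hK13symm : ∀ a b c d, K13 a b c d = K13 b a c d ∧ K13 a b c d = K13 a c b d ∧
      K13 a b c d = K13 a b d c) (f : ℕ → ℝ) :
    ∑ k ∈ Finset.Icc 1 I, (k : ℝ) * (C12 I K12 f k + C22 I K22 f k + C13 I K13 f k) = 0 := by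
  simp_rw [mul_add, Finset.sum_add_distrib]
  rw [C12_weak I K12 hK12symm f (fun k => (k : ℝ)), C22_weak I K22 hK22symm f (fun k => (k : ℝ)),
    C13_weak I K13 hK13symm f (fun k => (k : ℝ))]
  rw [Finset.sum_eq_zero, Finset.sum_eq_zero, Finset.sum_eq_zero]
  · ring
  all_goals intro a _; refine Finset.sum_eq_zero fun b _ => Finset.sum_eq_zero fun c _ => ?_
  · refine Finset.sum_eq_zero fun d _ => ?_
    split_ifs with h
    · rw [← h]; push_cast; ring
    · ring
  · refine Finset.sum_eq_zero fun d _ => ?_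
    split_ifs with h
    · have : (a : ℝ) + b = c + d := by exact_mod_cast h
      rw [this]; ring
    · ring
  · split_ifs with h
    · rw [← h]; push_cast; ring
    · ring

theorem aux_term12 (x y z : ℝ) (hx : 0 < x) (hy : 0 < y) (hz : 0 < z) :
    ((x + 1) * y * z - x * (y + 1) * (z + 1)) *
      ((Real.log x - Real.log (x + 1)) - (Real.log y - Real.log (y + 1))
        - (Real.log z - Real.log (z + 1))) ≤
      - (y / (y + 1) * (z / (z + 1)) - x / (x + 1)) ^ 2 := by
  have hx1 : 0 < x + 1 := by linarith
  have hy1 : 0 < y + 1 := by linarith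
  have hz1 : 0 < z + 1 := by linarith
  have hxg : x / (x + 1) ≤ 1 := by rw [div_le_one hx1]; linarith
  have hyg : y / (y + 1) ≤ 1 := by rw [div_le_one hy1]; linarith
  have hzg : z / (z + 1) ≤ 1 := by rw [div_le_one hz1]; linarith
  have h := aux_log_ineq (y / (y + 1) * (z / (z + 1))) (x / (x + 1)) (by positivity)
    (mul_le_one₀ hyg (by positivity) hzg) (by positivity) hxg
  rw [Real.log_mul (by positivity) (by positivity), Real.log_div hx.ne' hx1.ne',
    Real.log_div hy.ne' hy1.ne', Real.log_div hz.ne' hz1.ne'] at h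
  have e : (x + 1) * y * z - x * (y + 1) * (z + 1) =
    ((x + 1) * (y + 1) * (z + 1)) * (y / (y + 1) * (z / (z + 1)) - x / (x + 1)) := by
    field_simp
  rw [e]
  set u := y / (y + 1) * (z / (z + 1)) - x / (x + 1)
  have hP : 1 ≤ (x + 1) * (y + 1) * (z + 1) := by
    have : 1 ≤ (x + 1) * (y + 1) := by nlinarith
    nlinarith
  have h0 := sq_nonneg u
  nlinarith

theorem aux_diss (I : ℕ) 
    (K12 : ℕ → ℕ → ℕ → ℝ) (K22 K13 : ℕ → ℕ → ℕ → ℕ → ℝ)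
    (hK12pos : ∀ a b c, 0 < K12 a b c)
    (hK12symm : ∀ a b c, K12 a b c = K12 b a c ∧ K12 a b c = K12 a c b)
    (hK22pos : ∀ a b c d, 0 < K22 a b c d)
    (hK22symm : ∀ a b c d, K22 a b c d = K22 b a c d ∧ K22 a b c d = K22 a c b d ∧
      K22 a b c d = K22 a b d c)
    (hK13pos : ∀ a b c d, 0 < K13 a b c d)
    (hK13symm : ∀ a b c d, K13 a b c d = K13 b a c d ∧ K13 a b c d = K13 a c b d ∧
      K13 a b c d = K13 a b d c) (f : ℕ → ℝ)
    (hf : ∀ k ∈ Finset.Icc 1 I, 0 < f k) (j : ℕ) (hj : 1 ≤ j) (hjI : j + 1 ≤ I) :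
    ∑ k ∈ Finset.Icc 1 I, (Real.log (f k) - Real.log (f k + 1)) *
      (C12 I K12 f k + C22 I K22 f k + C13 I K13 f k) ≤
    - (K12 (j + 1) 1 j *
      (f 1 / (f 1 + 1) * (f j / (f j + 1)) - f (j + 1) / (f (j + 1) + 1)) ^ 2) := by
  simp_rw [mul_add, Finset.sum_add_distrib]
  rw [C12_weak I K12 hK12symm f (fun k => Real.log (f k) - Real.log (f k + 1)),
    C22_weak I K22 hK22symm f (fun k => Real.log (f k) - Real.log (f k + 1)),
    C13_weak I K13 hK13symm f (fun k => Real.log (f k) - Real.log (f k + 1))]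
  have h13 : ∑ a ∈ Finset.Icc 1 I, ∑ b ∈ Finset.Icc 1 I, ∑ c ∈ Finset.Icc 1 I,
      ∑ d ∈ Finset.Icc 1 I,
      (if b + c + d = a then
        K13 a b c d * ((f a + 1) * f b * f c * f d
          - f a * (f b + 1) * (f c + 1) * (f d + 1)) else 0)
        * ((Real.log (f a) - Real.log (f a + 1)) - (Real.log (f b) - Real.log (f b + 1))
          - (Real.log (f c) - Real.log (f c + 1)) - (Real.log (f d) - Real.log (f d + 1))) ≤ 0 := by
    refine Finset.sum_nonpos fun a ha => Finset.sum_nonpos fun b hb =>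
      Finset.sum_nonpos fun c hc => Finset.sum_nonpos fun d hd => ?_
    split_ifs
    · have ha := hf a ha
      have hb := hf b hb
      have hc := hf c hc
      have hd := hf d hd
      have h := aux_log_mono ((f a + 1) * f b * f c * f d)
        (f a * (f b + 1) * (f c + 1) * (f d + 1)) (by positivity) (by positivity)
      have e : Real.log (f a * (f b + 1) * (f c + 1) * (f d + 1)) -
        Real.log ((f a + 1) * f b * f c * f d) =
        ((Real.log (f a) - Real.log (f a + 1)) - (Real.log (f b) - Real.log (f b + 1))
          - (Real.log (f c) - Real.log (f c + 1)) - (Real.log (f d) - Real.log (f d + 1))) := by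
        repeat rw [Real.log_mul (by positivity) (by positivity)]
        ring
      rw [e] at h
      rw [mul_assoc]
      exact mul_nonpos_of_nonneg_of_nonpos (hK13pos _ _ _ _).le h
    · simp
  have h22 : ∑ a ∈ Finset.Icc 1 I, ∑ b ∈ Finset.Icc 1 I, ∑ c ∈ Finset.Icc 1 I,
      ∑ d ∈ Finset.Icc 1 I,
      (if a + b = c + d then
        K22 a b c d * ((f a + 1) * (f b + 1) * f c * f d
          - f a * f b * (f c + 1) * (f d + 1)) else 0)
        * ((Real.log (f a) - Real.log (f a + 1)) + (Real.log (f b) - Real.log (f b + 1))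
          - (Real.log (f c) - Real.log (f c + 1)) - (Real.log (f d) - Real.log (f d + 1))) ≤ 0 := by
    refine Finset.sum_nonpos fun a ha => Finset.sum_nonpos fun b hb =>
      Finset.sum_nonpos fun c hc => Finset.sum_nonpos fun d hd => ?_
    split_ifs
    · have ha := hf a ha
      have hb := hf b hb
      have hc := hf c hc
      have hd := hf d hd
      have h := aux_log_mono ((f a + 1) * (f b + 1) * f c * f d)
        (f a * f b * (f c + 1) * (f d + 1)) (by positivity) (by positivity)
      have e : Real.log (f a * f b * (f c + 1) * (f d + 1)) -
        Real.log ((f a + 1) * (f b + 1) * f c * f d) =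
        ((Real.log (f a) - Real.log (f a + 1)) + (Real.log (f b) - Real.log (f b + 1))
          - (Real.log (f c) - Real.log (f c + 1)) - (Real.log (f d) - Real.log (f d + 1))) := by
        repeat rw [Real.log_mul (by positivity) (by positivity)]
        ring
      rw [e] at h
      rw [mul_assoc]
      exact mul_nonpos_of_nonneg_of_nonpos (hK22pos _ _ _ _).le h
    · simp
  have ht : ∀ a ∈ Finset.Icc 1 I, ∀ b ∈ Finset.Icc 1 I, ∀ c ∈ Finset.Icc 1 I,
      (if b + c = a then
        K12 a b c * ((f a + 1) * f b * f c - f a * (f b + 1) * (f c + 1)) else 0)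
        * ((Real.log (f a) - Real.log (f a + 1)) - (Real.log (f b) - Real.log (f b + 1))
          - (Real.log (f c) - Real.log (f c + 1))) ≤ 
      (if b + c = a then
        - (K12 a b c * (f b / (f b + 1) * (f c / (f c + 1)) - f a / (f a + 1)) ^ 2) else 0) := by
    intro a ha b hb c hc
    split_ifs
    · have h := aux_term12 (f a) (f b) (f c) (hf a ha) (hf b hb) (hf c hc)
      rw [mul_assoc, ← mul_neg]
      exact mul_le_mul_of_nonneg_left h (hK12pos _ _ _).le
    · simp
  have ht0 : ∀ a ∈ Finset.Icc 1 I, ∀ b ∈ Finset.Icc 1 I, ∀ c ∈ Finset.Icc 1 I,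
      (if b + c = a then
        K12 a b c * ((f a + 1) * f b * f c - f a * (f b + 1) * (f c + 1)) else 0)
        * ((Real.log (f a) - Real.log (f a + 1)) - (Real.log (f b) - Real.log (f b + 1))
          - (Real.log (f c) - Real.log (f c + 1))) ≤ 0 := by
    intro a ha b hb c hc
    refine (ht a ha b hb c hc).trans ?_
    split_ifs
    · have := hK12pos a b c
      rw [neg_nonpos]
      positivity
    · exact le_rfl
  have single : ∀ (g : ℕ → ℝ) (i : ℕ), i ∈ Finset.Icc 1 I → (∀ k ∈ Finset.Icc 1 I, g k ≤ 0) →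
      ∑ k ∈ Finset.Icc 1 I, g k ≤ g i := by
    intro g i hi hg
    have := Finset.single_le_sum (f := fun k => - g k) (fun k hk => neg_nonneg.2 (hg k hk)) hi
    rw [Finset.sum_neg_distrib] at this
    linarith
  have hm1 : j + 1 ∈ Finset.Icc 1 I := by simp; omega
  have hm2 : 1 ∈ Finset.Icc 1 I := by simp; omega
  have hm3 : j ∈ Finset.Icc 1 I := by simp; omega
  have h12 := ((single _ (j + 1) hm1 (fun a ha => Finset.sum_nonpos fun b hb =>
      Finset.sum_nonpos fun c hc => ht0 a ha b hb c hc)).trans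
    (single _ 1 hm2 (fun b hb => Finset.sum_nonpos fun c hc => ht0 _ hm1 b hb c hc))).trans
    ((single _ j hm3 (fun c hc => ht0 _ hm1 1 hm2 c hc)).trans (ht _ hm1 1 hm2 j hm3))
  rw [if_pos (add_comm 1 j)] at h12
  linarith

theorem aux_decr (u : ℝ → ℝ) (u' : ℝ → ℝ)
    (h : ∀ t ∈ Set.Ici (0 : ℝ), HasDerivWithinAt u (u' t) (Set.Ici 0) t)
    (h0 : ∀ t ∈ Set.Ici (0 : ℝ), u' t ≤ 0) : ∀ t ∈ Set.Ici (0 : ℝ), u t ≤ u 0 := by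
  intro t ht
  have := antitoneOn_of_hasDerivWithinAt_nonpos (convex_Ici (0 : ℝ)) (f := u) (f' := u')
    (fun x hx => (h x hx).continuousWithinAt)
    (fun x hx => (h x (interior_subset hx)).mono interior_subset)
    (fun x hx => h0 x (interior_subset hx))
  exact this (Set.self_mem_Ici) ht ht

/-- Exponential convergence to the Bose–Einstein equilibrium for the combined
discrete system `dF/dt = 𝒞₁₂[F] + 𝒞₂₂[F] + 𝒞₁₃[F]`. -/
theorem C12_C22_C13_convergence_to_equilibrium (I : ℕ) (hI : 3 ≤ I)
    (K12 : ℕ → ℕ → ℕ → ℝ) (K22 K13 : ℕ → ℕ → ℕ → ℕ → ℝ)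
    (hK12pos : ∀ a b c, 0 < K12 a b c)
    (hK12symm : ∀ a b c, K12 a b c = K12 b a c ∧ K12 a b c = K12 a c b)
    (hK22pos : ∀ a b c d, 0 < K22 a b c d)
    (hK22symm : ∀ a b c d, K22 a b c d = K22 b a c d ∧ K22 a b c d = K22 a c b d ∧
      K22 a b c d = K22 a b d c)
    (hK13pos : ∀ a b c d, 0 < K13 a b c d)
    (hK13symm : ∀ a b c d, K13 a b c d = K13 b a c d ∧ K13 a b c d = K13 a c b d ∧
      K13 a b c d = K13 a b d c)
    (F : ℝ → ℕ → ℝ)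
    (hFpos : ∀ t ∈ Set.Ici (0 : ℝ), ∀ k ∈ Finset.Icc 1 I, 0 < F t k)
    (hF : ∀ t ∈ Set.Ici (0 : ℝ), ∀ k₁ ∈ Finset.Icc 1 I,
      HasDerivWithinAt (fun s => F s k₁)
        (C12 I K12 (F t) k₁ + C22 I K22 (F t) k₁ + C13 I K13 (F t) k₁) (Set.Ici 0) t) :
    ∃ ρ > (0 : ℝ), ∃ C₁ > (0 : ℝ), ∃ C₂ > (0 : ℝ),
      (∑ k ∈ Finset.Icc 1 I, (k : ℝ) / (Real.exp (ρ * k) - 1)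
        = ∑ k ∈ Finset.Icc 1 I, (k : ℝ) * F 0 k) ∧
      ∀ t ∈ Set.Ici (0 : ℝ), ∀ k ∈ Finset.Icc 1 I,
        |F t k - 1 / (Real.exp (ρ * k) - 1)| ≤ C₁ * Real.exp (-C₂ * t) := by
  have h1m : (1 : ℕ) ∈ Finset.Icc 1 I := by simp; omega
  set Q : ℝ → ℕ → ℝ := fun t k =>
    C12 I K12 (F t) k + C22 I K22 (F t) k + C13 I K13 (F t) k with hQ
  obtain ⟨E, hE⟩ : ∃ E, E = ∑ k ∈ Finset.Icc 1 I, (k : ℝ) * F 0 k := ⟨_, rfl⟩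
  have hQ0 : ∀ t, ∑ k ∈ Finset.Icc 1 I, (k : ℝ) * Q t k = 0 := fun t =>
    aux_energy I K12 K22 K13 hK12symm hK22symm hK13symm (F t)
  have hder : ∀ t ∈ Set.Ici (0 : ℝ), HasDerivWithinAt
      (fun s => ∑ k ∈ Finset.Icc 1 I, (k : ℝ) * F s k) 0 (Set.Ici 0) t := by
    intro t ht
    have := HasDerivWithinAt.fun_sum (u := Finset.Icc 1 I)
      (fun k hk => (hF t ht k hk).const_mul (k : ℝ))
    exact this.congr_deriv (hQ0 t)
  have hEt : ∀ t ∈ Set.Ici (0 : ℝ), ∑ k ∈ Finset.Icc 1 I, (k : ℝ) * F t k = E := by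
    intro t ht
    have h1 := aux_decr _ (fun _ => 0) hder (fun _ _ => le_rfl) t ht
    have h2 := aux_decr _ (fun _ => -0) (fun t ht => (hder t ht).neg) (fun _ _ => by simp) t ht
    simp only [Pi.neg_apply] at h2
    rw [hE]
    linarith
  have hFE : ∀ t ∈ Set.Ici (0 : ℝ), ∀ k ∈ Finset.Icc 1 I, F t k ≤ E := by
    intro t ht k hk
    rw [← hEt t ht]
    have h := Finset.single_le_sum (f := fun k : ℕ => (k : ℝ) * F t k)
      (fun j hj => mul_nonneg (Nat.cast_nonneg j) (hFpos t ht j hj).le) hk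
    have h2 : (1 : ℝ) ≤ k := by exact_mod_cast (Finset.mem_Icc.1 hk).1
    have := hFpos t ht k hk
    refine le_trans ?_ h
    nlinarith
  have h00 : (0 : ℝ) ∈ Set.Ici (0 : ℝ) := Set.self_mem_Ici
  have hE0 : 0 < E := (hFpos 0 h00 1 h1m).trans_le (hFE 0 h00 1 h1m)
  obtain ⟨r, hr0, hr1, hrE⟩ := aux_exists_r I hI E hE0
  have hrk : ∀ k ∈ Finset.Icc 1 I, r ^ k < 1 := fun k hk =>
    pow_lt_one₀ hr0.le hr1 (by have := (Finset.mem_Icc.1 hk).1; omega)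
  obtain ⟨g, hg⟩ : ∃ g : ℕ → ℝ, ∀ k, g k = r ^ k / (1 - r ^ k) := ⟨_, fun _ => rfl⟩
  have hgpos : ∀ k ∈ Finset.Icc 1 I, 0 < g k := by
    intro k hk
    rw [hg]
    exact div_pos (pow_pos hr0 k) (by linarith [hrk k hk])
  have hgE : ∀ k ∈ Finset.Icc 1 I, g k ≤ E := by
    intro k hk
    rw [← hrE]
    simp_rw [← hg]
    have h := Finset.single_le_sum (f := fun k : ℕ => (k : ℝ) * g k)
      (fun j hj => mul_nonneg (Nat.cast_nonneg j) (hgpos j hj).le) hk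
    have h2 : (1 : ℝ) ≤ k := by exact_mod_cast (Finset.mem_Icc.1 hk).1
    have := hgpos k hk
    refine le_trans ?_ h
    nlinarith
  have hgexp : ∀ k ∈ Finset.Icc 1 I, 1 / (Real.exp (-Real.log r * k) - 1) = g k := by
    intro k hk
    have h1 := hrk k hk
    have h2 : 0 < r ^ k := pow_pos hr0 k
    have : Real.exp (-Real.log r * k) = (r ^ k)⁻¹ := by
      rw [neg_mul, Real.exp_neg, mul_comm, Real.exp_nat_mul, Real.exp_log hr0]
    rw [this, hg]
    have h3 : 1 - r ^ k ≠ 0 := by linarith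
    rw [show (r ^ k)⁻¹ - 1 = (1 - r ^ k) / r ^ k by field_simp, one_div_div]
  have hglog : ∀ k ∈ Finset.Icc 1 I, Real.log (g k) - Real.log (g k + 1) = k * Real.log r := by
    intro k hk
    have h1 := hgpos k hk
    have h3 : 1 - r ^ k ≠ 0 := by linarith [hrk k hk]
    rw [← Real.log_div h1.ne' (by linarith), ← Real.log_pow]
    congr 1
    rw [div_eq_iff (by linarith), hg]
    field_simp
    ring
  obtain ⟨j0, -, hj0⟩ := Finset.exists_min_image (Finset.Icc 1 I) (fun j => K12 (j + 1) 1 j)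
    ⟨1, h1m⟩
  obtain ⟨κ, hκ, hκK⟩ : ∃ κ > 0, ∀ j ∈ Finset.Icc 1 I, κ ≤ K12 (j + 1) 1 j :=
    ⟨_, hK12pos _ _ _, hj0⟩
  set C := (E + 1) ^ 2 * I * (1 + (I : ℝ) ^ 2) with hC
  have hIpos : (0 : ℝ) < I := by exact_mod_cast (by omega : 0 < I)
  have hC0 : 0 < C := by positivity
  set D : ℝ → ℝ := fun t => - ∑ k ∈ Finset.Icc 1 I,
    (Real.log (F t k) - Real.log (F t k + 1)) * Q t k with hD
  have hDd : ∀ t ∈ Set.Ici (0 : ℝ), ∀ j, 1 ≤ j → j + 1 ≤ I →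
      κ * (F t 1 / (F t 1 + 1) * (F t j / (F t j + 1)) - F t (j + 1) / (F t (j + 1) + 1)) ^ 2
        ≤ D t := by
    intro t ht j hj hjI
    have h := aux_diss I K12 K22 K13 hK12pos hK12symm hK22pos hK22symm hK13pos hK13symm (F t)
      (hFpos t ht) j hj hjI
    have h2 := mul_le_mul_of_nonneg_right (hκK j (by simp; omega)) (sq_nonneg
      (F t 1 / (F t 1 + 1) * (F t j / (F t j + 1)) - F t (j + 1) / (F t (j + 1) + 1)))
    simp only [hD, hQ]
    linarith
  have hD0 : ∀ t ∈ Set.Ici (0 : ℝ), 0 ≤ D t := fun t ht =>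
    le_trans (by positivity) (hDd t ht 1 le_rfl (by omega))
  have hdist : ∀ t ∈ Set.Ici (0 : ℝ), ∀ k ∈ Finset.Icc 1 I,
      (F t k - g k) ^ 2 ≤ C ^ 2 * (D t / κ) := by
    intro t ht k hk
    have h := aux_stab I hI E r (Real.sqrt (D t / κ)) (F t) (hFpos t ht) hr0 hr1 (hEt t ht) hrE
      (hFE t ht) (Real.sqrt_nonneg _) (fun j hj hjI => by
        apply Real.abs_le_sqrt
        rw [le_div_iff₀ hκ, mul_comm]
        exact hDd t ht j hj hjI) k hk
    rw [← hg, ← hC] at h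
    rw [← sq_abs]
    calc _ ≤ (C * Real.sqrt (D t / κ)) ^ 2 := pow_le_pow_left₀ (abs_nonneg _) h 2
      _ = _ := by rw [mul_pow, Real.sq_sqrt (div_nonneg (hD0 t ht) hκ.le)]
  set V : ℝ → ℝ := fun t => ∑ k ∈ Finset.Icc 1 I, hrel (F t k) (g k) with hV
  set A := (∑ k ∈ Finset.Icc 1 I, 1 / g k) * (C ^ 2 / κ) with hA
  have hA0 : 0 < A := by
    have : 0 < ∑ k ∈ Finset.Icc 1 I, 1 / g k :=
      Finset.sum_pos (fun k hk => one_div_pos.2 (hgpos k hk)) ⟨1, h1m⟩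
    positivity
  have hVA : ∀ t ∈ Set.Ici (0 : ℝ), V t ≤ A * D t := by
    intro t ht
    rw [hA, mul_assoc, Finset.sum_mul]
    apply Finset.sum_le_sum
    intro k hk
    refine (hrel_upper _ _ (hFpos t ht k hk) (hgpos k hk)).trans ?_
    rw [div_eq_mul_one_div, mul_comm]
    apply mul_le_mul_of_nonneg_left _ (one_div_pos.2 (hgpos k hk)).le
    refine (hdist t ht k hk).trans (le_of_eq ?_)
    ring
  have hVd : ∀ t ∈ Set.Ici (0 : ℝ), HasDerivWithinAt V (- D t) (Set.Ici 0) t := by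
    intro t ht
    have := HasDerivWithinAt.fun_sum (u := Finset.Icc 1 I)
      (fun k hk => hrel_deriv (fun s => F s k) (g k) _ t _ (hF t ht k hk) (hFpos t ht k hk))
    refine this.congr_deriv ?_
    simp only [hD, neg_neg]
    have e : ∑ k ∈ Finset.Icc 1 I, (Real.log (g k) - Real.log (g k + 1)) * Q t k = 0 := by
      calc _ = ∑ k ∈ Finset.Icc 1 I, Real.log r * ((k : ℝ) * Q t k) := by
            apply Finset.sum_congr rfl
            intro k hk
            rw [hglog k hk]; ring
        _ = 0 := by rw [← Finset.mul_sum, hQ0 t, mul_zero]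
    simp_rw [sub_mul _ (Real.log (g _) - Real.log (g _ + 1))]
    rw [Finset.sum_sub_distrib]
    change _ - ∑ k ∈ Finset.Icc 1 I, (Real.log (g k) - Real.log (g k + 1)) * Q t k = _
    rw [e, sub_zero]
  have hVexp : ∀ t ∈ Set.Ici (0 : ℝ), V t * Real.exp (1 / A * t) ≤ V 0 := by
    intro t ht
    have h := aux_decr (fun t => V t * Real.exp (1 / A * t))
      (fun t => - D t * Real.exp (1 / A * t) + V t * (Real.exp (1 / A * t) * (1 / A)))
      (fun t ht => (hVd t ht).mul (by
        have := ((hasDerivAt_id t).const_mul (1 / A)).exp.hasDerivWithinAt (s := Set.Ici 0)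
        simpa using this)) (fun t ht => by
        have h1 : V t * (1 / A) ≤ D t := by
          rw [mul_one_div, div_le_iff₀ hA0, mul_comm]
          exact hVA t ht
        have h2 := Real.exp_pos (1 / A * t)
        nlinarith) t ht
    simpa using h
  have hV0 : 0 ≤ V 0 := Finset.sum_nonneg fun k hk =>
    hrel_nonneg _ _ (hFpos 0 h00 k hk) (hgpos k hk)
  refine ⟨-Real.log r, by linarith [Real.log_neg hr0 hr1],
    Real.sqrt (4 * (E + 1) ^ 2 * V 0) + 1, by positivity, 1 / A / 2, by positivity, ?_, ?_⟩
  · rw [← hE, ← hrE]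
    apply Finset.sum_congr rfl
    intro k hk
    rw [← hg, ← hgexp k hk, mul_one_div]
  · intro t ht k hk
    rw [hgexp k hk]
    have h1 := hrel_lower E (F t k) (g k) (hFpos t ht k hk) (hgpos k hk) (hFE t ht k hk) (hgE k hk)
    have h2 : hrel (F t k) (g k) ≤ V t :=
      Finset.single_le_sum (f := fun k => hrel (F t k) (g k))
        (fun k hk => hrel_nonneg _ _ (hFpos t ht k hk) (hgpos k hk)) hk
    have h3 : V t ≤ V 0 * Real.exp (-(1 / A * t)) := by
      rw [Real.exp_neg, ← div_eq_mul_inv, le_div_iff₀ (Real.exp_pos _)]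
      exact hVexp t ht
    rw [div_le_iff₀ (by positivity)] at h1
    have h4 : (F t k - g k) ^ 2 ≤ 4 * (E + 1) ^ 2 * V 0 * Real.exp (-(1 / A * t)) := by
      refine h1.trans ?_
      rw [mul_comm, mul_assoc _ (V 0)]
      exact mul_le_mul_of_nonneg_left (h2.trans h3) (by positivity)
    have h5 : Real.exp (-(1 / A * t)) = Real.exp (-(1 / A / 2) * t) ^ 2 := by
      rw [← Real.exp_nat_mul]; congr 1; push_cast; ring
    have h6 := Real.abs_le_sqrt h4
    rw [h5, Real.sqrt_mul (by positivity), Real.sqrt_sq (Real.exp_pos _).le] at h6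
    refine h6.trans ?_
    apply mul_le_mul_of_nonneg_right _ (Real.exp_pos _).le
    linarith
end

section
/- Let p₁, p₂, p₃, p₄ ∈ ℤ³ be nonzero vectors such that p₁ = p₂ + p₃ + p₄ and |p₁| = |p₂| + |p₃| + |p₄| (Euclidean norms). Then there exist a vector P ∈ ℤ³ and positive integers k₁, k₂, k₃, k₄ such that pᵢ = kᵢP for i = 1, 2, 3, 4 and k₁ = k₂ + k₃ + k₄. -/
/-- Euclidean norm of an integer vector in `ℤ³`. -/
noncomputable def znorm (p : Fin 3 → ℤ) : ℝ :=
  Real.sqrt (∑ i, ((p i : ℝ)) ^ 2)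

noncomputable def zvec (p : Fin 3 → ℤ) : EuclideanSpace ℝ (Fin 3) :=
  WithLp.toLp 2 (fun i => (p i : ℝ))

theorem znorm_eq (p : Fin 3 → ℤ) : znorm p = ‖zvec p‖ := by
  simp [znorm, zvec, EuclideanSpace.norm_eq]

theorem zvec_add (p q : Fin 3 → ℤ) : zvec (p + q) = zvec p + zvec q := by
  ext i
  simp [zvec]

theorem zvec_ne (p : Fin 3 → ℤ) (h : p ≠ 0) : zvec p ≠ 0 := by
  intro h0
  apply h
  ext i
  have := congrArg (fun v : EuclideanSpace ℝ (Fin 3) => v i) h0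
  simpa [zvec] using this

theorem ray_aux (p q r s : Fin 3 → ℤ) (hp : p ≠ 0) (hq : q ≠ 0) (hsum : p = q + (r + s))
    (hnorm : znorm p = znorm q + (znorm r + znorm s)) :
    ∃ t : ℝ, 0 < t ∧ ∀ i, (q i : ℝ) = t * (p i : ℝ) := by
  have hs : zvec p = zvec q + (zvec r + zvec s) := by rw [hsum, zvec_add, zvec_add]
  simp only [znorm_eq] at hnorm
  have h1 : SameRay ℝ (zvec q) (zvec r + zvec s) := by
    rw [sameRay_iff_norm_add]
    have a := norm_add_le (zvec q) (zvec r + zvec s)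
    have b := norm_add_le (zvec r) (zvec s)
    rw [hs] at hnorm
    linarith
  have h2 : SameRay ℝ (zvec q) (zvec p) := by
    rw [hs]
    exact (SameRay.refl _).add_right h1
  obtain ⟨t, ht, h⟩ := h2.exists_pos_right (zvec_ne q hq) (zvec_ne p hp)
  refine ⟨t, ht, fun i => ?_⟩
  have := congrArg (fun v : EuclideanSpace ℝ (Fin 3) => v i) h
  simpa [zvec] using this

theorem prim_aux (p : Fin 3 → ℤ) (hp : p ≠ 0) :
    ∃ (P u : Fin 3 → ℤ) (g : ℤ), 0 < g ∧ (∀ i, p i = g * P i) ∧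
      u 0 * P 0 + u 1 * P 1 + u 2 * P 2 = 1 := by
  have e1 := Int.gcd_eq_gcd_ab (p 0) (p 1)
  have e2 := Int.gcd_eq_gcd_ab (Int.gcd (p 0) (p 1) : ℤ) (p 2)
  have d0 := Int.gcd_dvd_left (p 0) (p 1)
  have d1 := Int.gcd_dvd_right (p 0) (p 1)
  have d3 := Int.gcd_dvd_left (Int.gcd (p 0) (p 1) : ℤ) (p 2)
  have d2 := Int.gcd_dvd_right (Int.gcd (p 0) (p 1) : ℤ) (p 2)
  have hg0 : (0:ℤ) ≤ (Int.gcd (Int.gcd (p 0) (p 1) : ℤ) (p 2) : ℤ) := Int.natCast_nonneg _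
  generalize (Int.gcd (Int.gcd (p 0) (p 1) : ℤ) (p 2) : ℤ) = g at *
  obtain ⟨a, ha⟩ := d3.trans d0
  obtain ⟨b, hb⟩ := d3.trans d1
  obtain ⟨c, hc⟩ := d2
  have hg : g ≠ 0 := by
    rintro rfl
    apply hp
    ext i
    fin_cases i
    · simpa using ha
    · simpa using hb
    · simpa using hc
  generalize (Int.gcd (p 0) (p 1) : ℤ) = h at *
  generalize Int.gcdA (p 0) (p 1) = x at *
  generalize Int.gcdB (p 0) (p 1) = y at *
  generalize Int.gcdA h (p 2) = z at *
  generalize Int.gcdB h (p 2) = w at *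
  refine ⟨![a, b, c], ![x * z, y * z, w], g, lt_of_le_of_ne hg0 hg.symm, ?_, ?_⟩
  · intro i
    fin_cases i <;> simp [ha, hb, hc]
  · apply mul_left_cancel₀ hg
    simp only [Matrix.cons_val]
    rw [ha, hb] at e1
    rw [hc, e1] at e2
    linear_combination -e2

theorem mult_aux (p q P u : Fin 3 → ℤ) (g : ℤ) (t : ℝ) (hg : 0 < g) (ht : 0 < t)
    (hP : ∀ i, p i = g * P i) (hu : u 0 * P 0 + u 1 * P 1 + u 2 * P 2 = 1)
    (hq : ∀ i, (q i : ℝ) = t * (p i : ℝ)) :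
    0 < u 0 * q 0 + u 1 * q 1 + u 2 * q 2 ∧
      q = (u 0 * q 0 + u 1 * q 1 + u 2 * q 2) • P := by
  have hq' : ∀ i, (q i : ℝ) = t * (g * P i) := fun i => by rw [hq, hP]; push_cast; rfl
  have hu' : (u 0 * P 0 + u 1 * P 1 + u 2 * P 2 : ℝ) = 1 := by exact_mod_cast hu
  have hk : ((u 0 * q 0 + u 1 * q 1 + u 2 * q 2 : ℤ) : ℝ) = t * g := by
    push_cast
    rw [hq', hq', hq']
    linear_combination t * g * hu'
  have hg' : (0:ℝ) < g := by exact_mod_cast hg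
  constructor
  · have : (0:ℝ) < ((u 0 * q 0 + u 1 * q 1 + u 2 * q 2 : ℤ) : ℝ) := by rw [hk]; positivity
    exact_mod_cast this
  · ext i
    have : (q i : ℝ) = ((u 0 * q 0 + u 1 * q 1 + u 2 * q 2 : ℤ) : ℝ) * P i := by
      rw [hk, hq']; ring
    rw [Pi.smul_apply, smul_eq_mul]
    exact_mod_cast this

/-- Decoupling lemma for the `C₁₃` collision operator: nonzero integer vectors
with `p₁ = p₂ + p₃ + p₄` and `|p₁| = |p₂| + |p₃| + |p₄|` are positive integer
multiples of a common integer vector `P`. -/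
theorem decoupling_C13 (p₁ p₂ p₃ p₄ : Fin 3 → ℤ)
    (h₁ : p₁ ≠ 0) (h₂ : p₂ ≠ 0) (h₃ : p₃ ≠ 0) (h₄ : p₄ ≠ 0)
    (hsum : p₁ = p₂ + p₃ + p₄)
    (hnorm : znorm p₁ = znorm p₂ + znorm p₃ + znorm p₄) :
    ∃ (P : Fin 3 → ℤ) (k₁ k₂ k₃ k₄ : ℕ), 0 < k₁ ∧ 0 < k₂ ∧ 0 < k₃ ∧ 0 < k₄ ∧
      p₁ = (k₁ : ℤ) • P ∧ p₂ = (k₂ : ℤ) • P ∧ p₃ = (k₃ : ℤ) • P ∧ p₄ = (k₄ : ℤ) • P ∧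
      k₁ = k₂ + k₃ + k₄ := by
  obtain ⟨t₂, ht₂, e₂⟩ := ray_aux p₁ p₂ p₃ p₄ h₁ h₂ (by rw [hsum]; abel) (by linarith)
  obtain ⟨t₃, ht₃, e₃⟩ := ray_aux p₁ p₃ p₂ p₄ h₁ h₃ (by rw [hsum]; abel) (by linarith)
  obtain ⟨t₄, ht₄, e₄⟩ := ray_aux p₁ p₄ p₂ p₃ h₁ h₄ (by rw [hsum]; abel) (by linarith)
  obtain ⟨P, u, g, hg, hP, hu⟩ := prim_aux p₁ h₁
  obtain ⟨a₁, b₁⟩ := mult_aux p₁ p₁ P u g 1 hg one_pos hP hu (by simp)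
  obtain ⟨a₂, b₂⟩ := mult_aux p₁ p₂ P u g t₂ hg ht₂ hP hu e₂
  obtain ⟨a₃, b₃⟩ := mult_aux p₁ p₃ P u g t₃ hg ht₃ hP hu e₃
  obtain ⟨a₄, b₄⟩ := mult_aux p₁ p₄ P u g t₄ hg ht₄ hP hu e₄
  have hk : u 0 * p₁ 0 + u 1 * p₁ 1 + u 2 * p₁ 2 = (u 0 * p₂ 0 + u 1 * p₂ 1 + u 2 * p₂ 2)
      + (u 0 * p₃ 0 + u 1 * p₃ 1 + u 2 * p₃ 2) + (u 0 * p₄ 0 + u 1 * p₄ 1 + u 2 * p₄ 2) := by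
    rw [hsum]
    simp only [Pi.add_apply]
    ring
  generalize u 0 * p₁ 0 + u 1 * p₁ 1 + u 2 * p₁ 2 = k₁ at *
  generalize u 0 * p₂ 0 + u 1 * p₂ 1 + u 2 * p₂ 2 = k₂ at *
  generalize u 0 * p₃ 0 + u 1 * p₃ 1 + u 2 * p₃ 2 = k₃ at *
  generalize u 0 * p₄ 0 + u 1 * p₄ 1 + u 2 * p₄ 2 = k₄ at *
  lift k₁ to ℕ using a₁.le
  lift k₂ to ℕ using a₂.le
  lift k₃ to ℕ using a₃.le
  lift k₄ to ℕ using a₄.le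
  exact ⟨P, k₁, k₂, k₃, k₄, by omega, by omega, by omega, by omega, b₁, b₂, b₃, b₄, by omega⟩
end
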